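/- arXiv:2509.14339 — 4 statements merged into one kernel-verified Lean document; each statement's English description precedes it below -/
import Mathlib

section
/- Let G be an abelian group and let A be a nonempty finite subset of G. Then there exists a matching from A to itself if and only if 0 ∉ A. -/
/-! ### Matchings in abelian groups -/

/-- A matching from the finite subset `A` to the finite subset `B` of an additive
group: a bijection `f` from `A` onto `B` such that `a + f a ∉ A` for all `a ∈ A`. -/
def IsMatchedTo {G : Type*} [AddGroup G] (A B : Finset G) : Prop :=
  ∃ f : G → G, Set.BijOn f ↑A ↑B ∧ ∀ a ∈ A, a + f a ∉ A

/-- `pGT G n` says that every nontrivial finite subgroup of `G` has more than `n`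
elements; this is the meaning of `n < p(G)`, where `p(G)` is the smallest
cardinality of a nontrivial finite subgroup of `G` (`p(G) = ∞` if none exists). -/
def pGT (G : Type*) [AddGroup G] (n : ℕ) : Prop :=
  ∀ H : AddSubgroup G, H ≠ ⊥ → ∀ _ : Finite H, n < Nat.card H

/-- `A` is a progression with difference `x`: `A = {a, a+x, ..., a+(k-1)x}`
for some initial term `a` and some positive length `k`. -/
def IsAPWith {G : Type*} [AddGroup G] (x : G) (A : Set G) : Prop :=
  ∃ a : G, ∃ k : ℕ, 0 < k ∧ A = (fun i : ℕ => a + i • x) '' Set.Iio k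

/-- `A` is a progression. -/
def IsAP {G : Type*} [AddGroup G] (A : Set G) : Prop :=
  ∃ x : G, IsAPWith x A

/-- `A` is a semi-progression: `A \ {a}` is a progression for some `a ∈ A`. -/
def IsSemiAP {G : Type*} [AddGroup G] (A : Set G) : Prop :=
  ∃ a ∈ A, IsAP (A \ {a})

open Finset in
/-- **Scherk's inequality**: if `0` has only the trivial representation as a sum of an element
of `A` and an element of `B`, then every set containing `A + B` has at least
`#A + #B - 1` elements. -/
theorem card_add_card_le_card_add_one_of_add_mem {G : Type*} [AddCommGroup G] {A B C : Finset G}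
    (hA : (0 : G) ∈ A) (hB : (0 : G) ∈ B) (hAB : ∀ a ∈ A, ∀ b ∈ B, a + b = 0 → b = 0)
    (hC : ∀ a ∈ A, ∀ b ∈ B, a + b ∈ C) : #A + #B ≤ #C + 1 := by
  classical
  induction hn : #B using Nat.strong_induction_on generalizing A B with
  | _ n ih =>
  subst hn
  by_cases h : ∃ e ∈ A, ∃ b ∈ B, e + b ∉ A
  · obtain ⟨e, he, b₀, hb₀, heb₀⟩ := h
    have hlt : #{b ∈ B | e + b ∈ A} < #B :=
      card_lt_card (filter_ssubset.2 ⟨b₀, hb₀, heb₀⟩)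
    have hcard : #(A ∪ B.image (e + ·)) + #{b ∈ B | e + b ∈ A} = #A + #B := by
      have hinter : A ∩ B.image (e + ·) = {b ∈ B | e + b ∈ A}.image (e + ·) := by
        ext x
        simp only [mem_inter, mem_image, mem_filter]
        grind
      have := card_union_add_card_inter A (B.image (e + ·))
      rwa [hinter, card_image_of_injective _ (add_right_injective e),
        card_image_of_injective _ (add_right_injective e)] at this
    rw [← hcard]
    refine ih _ hlt (mem_union_left _ hA) (mem_filter.2 ⟨hB, by simpa using he⟩) ?_ ?_ rfl
    · intro a ha b hb hab
      rw [mem_filter] at hb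
      rcases mem_union.1 ha with ha | ha
      · exact hAB a ha b hb.1 hab
      · obtain ⟨c, hc, rfl⟩ := mem_image.1 ha
        have hc0 : c = 0 := hAB _ hb.2 c hc (by rw [← hab]; abel)
        exact hAB e he b hb.1 (by simpa [hc0] using hab)
    · intro a ha b hb
      rw [mem_filter] at hb
      rcases mem_union.1 ha with ha | ha
      · exact hC a ha b hb.1
      · obtain ⟨c, hc, rfl⟩ := mem_image.1 ha
        rw [add_right_comm]
        exact hC _ hb.2 c hc
  · push Not at h
    have hB0 : B ⊆ {0} := by
      intro b hb
      have hsurj := surjOn_of_injOn_of_card_le (s := A) (t := A) (· + b)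
        (fun a ha => h a ha b hb) (add_left_injective b).injOn le_rfl
      obtain ⟨a, ha, hab⟩ := hsurj hA
      exact mem_singleton.2 (hAB a ha b hb hab)
    have hAC : A ⊆ C := fun a ha => by simpa using hC a ha 0 hB
    exact add_le_add (card_le_card hAC) (card_le_card hB0)

open Finset in
/-- If `S, T ⊆ A`, `S + T ⊆ A` and `0 ∉ A`, then `#S + #T ≤ #A`. -/
theorem card_add_card_le_of_add_mem {G : Type*} [AddCommGroup G] {A S T : Finset G}
    (hA : (0 : G) ∉ A) (hS : S ⊆ A) (hT : T ⊆ A) (hST : ∀ s ∈ S, ∀ t ∈ T, s + t ∈ A) :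
    #S + #T ≤ #A := by
  classical
  have key := card_add_card_le_card_add_one_of_add_mem (A := insert 0 S) (B := insert 0 T)
    (C := insert 0 A) (mem_insert_self _ _) (mem_insert_self _ _)
    (by
      intro s hs t ht hst
      rcases mem_insert.1 hs with rfl | hs
      · simpa using hst
      rcases mem_insert.1 ht with rfl | ht
      · rfl
      · exact absurd (hst ▸ hST s hs t ht) hA)
    (by
      intro s hs t ht
      rcases mem_insert.1 hs with rfl | hs
      · rw [zero_add]
        exact insert_subset_insert 0 hT ht
      rcases mem_insert.1 ht with rfl | ht
      · rw [add_zero]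
        exact mem_insert_of_mem (hS hs)
      · exact mem_insert_of_mem (hST s hs t ht))
  rw [card_insert_of_notMem hA, card_insert_of_notMem fun h => hA (hS h),
    card_insert_of_notMem fun h => hA (hT h)] at key
  omega

theorem matching_self_iff {G : Type*} [AddCommGroup G] (A : Finset G)
    (hA : A.Nonempty) :
    IsMatchedTo A A ↔ (0 : G) ∉ A := by
  classical
  constructor
  · rintro ⟨f, hf, hfA⟩ h0
    obtain ⟨a, ha, hfa⟩ := hf.surjOn h0
    exact hfA a ha (by rw [hfa, add_zero]; exact ha)
  · intro h0
    have hall : ∀ S : Finset {x // x ∈ A},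
        S.card ≤ (S.biUnion fun a => A.filter fun b => (a : G) + b ∉ A).card := by
      intro S
      let T := A.filter fun b => ∀ s ∈ S, (s : G) + b ∈ A
      have hTA : T ⊆ A := Finset.filter_subset _ _
      have hST := card_add_card_le_of_add_mem (S := S.map (Function.Embedding.subtype _)) h0
        (Finset.map_subtype_subset S) hTA (by
          intro s hs t ht
          obtain ⟨s, hsS, rfl⟩ := Finset.mem_map.1 hs
          exact (Finset.mem_filter.1 ht).2 s hsS)
      have hsub : A \ T ⊆ S.biUnion fun a => A.filter fun b => (a : G) + b ∉ A := by
        intro b hb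
        simp only [T, Finset.mem_sdiff, Finset.mem_filter, not_and, not_forall] at hb
        obtain ⟨s, hs, hsb⟩ := hb.2 hb.1
        exact Finset.mem_biUnion.2 ⟨s, hs, Finset.mem_filter.2 ⟨hb.1, hsb⟩⟩
      have hle := Finset.card_le_card hsub
      have hsd := Finset.card_sdiff_add_card_eq_card hTA
      rw [Finset.card_map] at hST
      omega
    obtain ⟨f, hinj, hf⟩ :=
      (Finset.all_card_le_biUnion_card_iff_exists_injective _).1 hall
    let g : G → G := fun x => if h : x ∈ A then f ⟨x, h⟩ else 0
    have hg : ∀ x (h : x ∈ A), g x = f ⟨x, h⟩ := fun x h => dif_pos h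
    have hmaps : Set.MapsTo g A A := fun x hx => by
      rw [hg x hx]
      exact (Finset.mem_filter.1 (hf ⟨x, hx⟩)).1
    have hinjOn : Set.InjOn g A := fun x hx y hy hxy => by
      rw [hg x hx, hg y hy] at hxy
      exact congrArg Subtype.val (hinj hxy)
    refine ⟨g, ⟨hmaps, hinjOn, Finset.surjOn_of_injOn_of_card_le g hmaps hinjOn le_rfl⟩,
      fun a ha => ?_⟩
    rw [hg a ha]
    exact (Finset.mem_filter.1 (hf ⟨a, ha⟩)).2
end

section
/- Let G be an abelian group, and let A and B be nonempty finite subsets of G with |A| = |B| < p(G) and 0 ∉ B. Then there exists a matching from A to B. -/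
open scoped Pointwise in
/-- If `S + U ⊆ A` with `0 ∉ U`, and `A` is smaller than every nontrivial subgroup, then
`|S| + |U| ≤ |A|`. -/
lemma card_add_card_le_of_add_mem_s2 {G : Type*} [AddCommGroup G] {A S U : Finset G}
    (hp : pGT G A.card) (hS : S.Nonempty) (hSA : S ⊆ A) (h0 : (0 : G) ∉ U)
    (hU : ∀ s ∈ S, ∀ u ∈ U, s + u ∈ A) : S.card + U.card ≤ A.card := by
  classical
  have hmin : ((A.card + 1 : ℕ) : ℕ∞) ≤ AddMonoid.minOrder G := by
    rw [AddMonoid.le_minOrder]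
    intro a ha hfin
    have hlt := hp (AddSubgroup.zmultiples a) (by simpa using ha) hfin.finite_zmultiples
    rw [Nat.card_zmultiples] at hlt
    exact_mod_cast hlt
  have hsub : S + insert 0 U ⊆ A := by
    intro x hx
    obtain ⟨s, hs, u, hu, rfl⟩ := Finset.mem_add.1 hx
    rcases Finset.mem_insert.1 hu with rfl | hu
    · simpa using hSA hs
    · exact hU s hs u hu
  have hle := Finset.card_le_card hsub
  have hcd := cauchy_davenport_minOrder_add hS (Finset.insert_nonempty 0 U)
  rw [Finset.card_insert_of_notMem h0] at hcd
  rcases min_le_iff.1 hcd with h | h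
  · have := Nat.cast_le.1 (hmin.trans h)
    omega
  · have := Nat.cast_le.1 h
    omega

theorem matchable_of_card_lt_p {G : Type*} [AddCommGroup G] (A B : Finset G)
    (hA : A.Nonempty) (hB : B.Nonempty) (hcard : A.card = B.card)
    (hp : pGT G A.card) (h0 : (0 : G) ∉ B) :
    IsMatchedTo A B := by
  classical
  obtain ⟨f, hf, hmem⟩ := (Finset.all_card_le_biUnion_card_iff_exists_injective
    (fun a : A => B.filter fun b => (a : G) + b ∉ A)).1 fun S => by
      rcases S.eq_empty_or_nonempty with rfl | hS
      · simp
      set N := S.biUnion fun a : A => B.filter fun b => (a : G) + b ∉ A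
      have hNB : N ⊆ B := Finset.biUnion_subset.2 fun _ _ => Finset.filter_subset _ _
      have hle := card_add_card_le_of_add_mem_s2 (S := S.map (Function.Embedding.subtype _))
        (U := B \ N) hp (by simpa using hS) (Finset.map_subtype_subset S)
        (fun h => h0 (Finset.mem_sdiff.1 h).1) (by
          intro s hs u hu
          obtain ⟨a, ha, rfl⟩ := Finset.mem_map.1 hs
          obtain ⟨huB, huN⟩ := Finset.mem_sdiff.1 hu
          by_contra hnot
          exact huN (Finset.mem_biUnion.2 ⟨a, ha, Finset.mem_filter.2 ⟨huB, hnot⟩⟩))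
      rw [Finset.card_map] at hle
      have := Finset.card_sdiff_add_card_eq_card hNB
      omega
  have hg : ∀ a (ha : a ∈ A), (fun x => if hx : x ∈ A then f ⟨x, hx⟩ else 0) a = f ⟨a, ha⟩ :=
    fun a ha => dif_pos ha
  refine ⟨fun x => if hx : x ∈ A then f ⟨x, hx⟩ else 0, ?_, fun a ha => ?_⟩
  · have hmaps : Set.MapsTo (fun x => if hx : x ∈ A then f ⟨x, hx⟩ else 0) (A : Set G) B := by
      intro a ha
      rw [hg a ha]
      exact (Finset.mem_filter.1 (hmem ⟨a, ha⟩)).1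
    have hinj : Set.InjOn (fun x => if hx : x ∈ A then f ⟨x, hx⟩ else 0) (A : Set G) := by
      intro a ha b hb hab
      rw [hg a ha, hg b hb] at hab
      exact congrArg Subtype.val (hf hab)
    exact ⟨hmaps, hinj, Finset.surjOn_of_injOn_of_card_le _ hmaps hinj hcard.ge⟩
  · rw [hg a ha]
    exact (Finset.mem_filter.1 (hmem ⟨a, ha⟩)).2
end

section
/- Let G be a finite abelian group and let A, B be finite subsets of G with |A| > 1, |B| > 1, |G| > |A+B| = |A| + |B| − 1, and |A| + |B| − 1 ≤ p(G) − 2. Then A and B are both progressions with the same common difference. -/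
open scoped Pointwise

/-- Cauchy-Davenport in a group in which every nonzero element has order greater than `n`. -/
lemma card_add_card_le_of_lt_addOrderOf {G : Type*} [AddCommGroup G] [DecidableEq G] {n : ℕ}
    (hp : ∀ d : G, d ≠ 0 → n < addOrderOf d) {S T : Finset G} (hS : S.Nonempty)
    (hT : T.Nonempty) (hn : (S + T).card ≤ n) : S.card + T.card ≤ (S + T).card + 1 := by
  have h := cauchy_davenport_minOrder_add hS hT
  have hmin : ((n + 1 : ℕ) : ℕ∞) ≤ AddMonoid.minOrder G := by
    rw [AddMonoid.le_minOrder]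
    intro d hd _
    exact_mod_cast hp d hd
  rcases min_le_iff.1 h with h | h
  · have := hmin.trans h
    norm_cast at this
    omega
  · norm_cast at h
    omega

/-- A finite set that gains at most one element under addition of `{0, d}` is a progression
with difference `d`, provided that the order of `d` exceeds its cardinality. -/
lemma exists_eq_image_range_of_card_add_pair_le {G : Type*} [AddCommGroup G] [DecidableEq G]
    {S : Finset G} {d : G} (hS : S.Nonempty) (hd : S.card < addOrderOf d)
    (h : (S + {0, d}).card ≤ S.card + 1) :
    ∃ a : G, S = (Finset.range S.card).image (fun i : ℕ => a + i • d) := by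
  have walk : ∀ s ∈ S, ∃ i < S.card, s - i • d ∈ S ∧ s - i • d - d ∉ S := by
    intro s hs
    by_contra! hcon
    have hmem : ∀ i ≤ S.card, s - i • d ∈ S := by
      intro i
      induction i with
      | zero => simpa using hs
      | succ i ih =>
        intro hi
        have := hcon i (by omega) (ih (by omega))
        rwa [succ_nsmul, ← sub_sub]
    have hinj : Set.InjOn (fun i : ℕ => s - i • d) (Finset.range (S.card + 1)) := by
      intro i hi j hj hij
      simp only [Finset.coe_range, Set.mem_Iio] at hi hj
      have hij : i • d = j • d := sub_right_injective hij
      exact nsmul_injOn_Iio_addOrderOf (Set.mem_Iio.2 (by omega)) (Set.mem_Iio.2 (by omega)) hij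
    have hle := Finset.card_le_card_of_injOn (s := Finset.range (S.card + 1)) (t := S)
      (fun i : ℕ => s - i • d)
      (fun i hi => hmem i (by simpa [Nat.lt_succ_iff] using hi)) hinj
    simp at hle
  have huniq : (S.filter (fun s => s - d ∉ S)).card ≤ 1 := by
    have hsub : S.filter (fun s => s - d ∉ S) ∪ S.image (· + d) ⊆ S + {0, d} := by
      intro x hx
      simp only [Finset.mem_union, Finset.mem_filter, Finset.mem_image] at hx
      rcases hx with ⟨hx, -⟩ | ⟨y, hy, rfl⟩
      · simpa using Finset.add_mem_add hx (Finset.mem_insert_self 0 {d})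
      · exact Finset.add_mem_add hy (by simp)
    have hdisj : Disjoint (S.filter (fun s => s - d ∉ S)) (S.image (· + d)) := by
      rw [Finset.disjoint_left]
      intro x hx hx'
      obtain ⟨y, hy, rfl⟩ := Finset.mem_image.1 hx'
      simp [hy] at hx
    have := Finset.card_le_card hsub
    rw [Finset.card_union_of_disjoint hdisj,
      Finset.card_image_of_injective _ (add_left_injective d)] at this
    omega
  obtain ⟨s, hs⟩ := hS
  obtain ⟨i, -, ha, ha'⟩ := walk s hs
  refine ⟨s - i • d, Finset.eq_of_subset_of_card_le ?_ ?_⟩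
  · intro t ht
    obtain ⟨j, hj, hb, hb'⟩ := walk t ht
    have heq := Finset.card_le_one.1 huniq _ (Finset.mem_filter.2 ⟨ha, ha'⟩) _
      (Finset.mem_filter.2 ⟨hb, hb'⟩)
    exact Finset.mem_image.2 ⟨j, Finset.mem_range.2 hj, by rw [heq]; abel⟩
  · simpa using Finset.card_image_le (s := Finset.range S.card)
      (f := fun j : ℕ => s - i • d + j • d)

/-- The sumset of two progressions with difference `d` and the pair `{0, d}` is small. -/
lemma card_add_add_pair_le {G : Type*} [AddCommGroup G] [DecidableEq G] {A B : Finset G}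
    {a b d : G} {k l : ℕ} (hA : A = (Finset.range k).image (fun i : ℕ => a + i • d))
    (hB : B = (Finset.range l).image (fun i : ℕ => b + i • d)) :
    (A + B + {0, d}).card ≤ k + l := by
  have hsub : A + B + {0, d} ⊆ (Finset.range (k + l)).image (fun i : ℕ => a + b + i • d) := by
    intro x hx
    obtain ⟨y, hy, z, hz, rfl⟩ := Finset.mem_add.1 hx
    obtain ⟨u, hu, v, hv, rfl⟩ := Finset.mem_add.1 hy
    rw [hA] at hu
    rw [hB] at hv
    obtain ⟨i, hi, rfl⟩ := Finset.mem_image.1 hu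
    obtain ⟨j, hj, rfl⟩ := Finset.mem_image.1 hv
    rw [Finset.mem_range] at hi hj
    rw [Finset.mem_insert, Finset.mem_singleton] at hz
    rcases hz with rfl | rfl
    · exact Finset.mem_image.2 ⟨i + j, Finset.mem_range.2 (by omega), by rw [add_nsmul]; abel⟩
    · exact Finset.mem_image.2 ⟨i + j + 1, Finset.mem_range.2 (by omega), by
        rw [succ_nsmul, add_nsmul]; abel⟩
  simpa using (Finset.card_le_card hsub).trans Finset.card_image_le

/-- Dyson's e-transform of a critical pair `(A, B)` with `|B| ≥ 3` can be chosen so that the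
second set shrinks but keeps at least two elements. -/
lemma exists_dyson_transform {G : Type*} [AddCommGroup G] [DecidableEq G] {A B : Finset G}
    (hp : ∀ d : G, d ≠ 0 → A.card + B.card < addOrderOf d) (hA : 1 < A.card)
    (hB : 2 < B.card) (hcrit : (A + B).card + 1 = A.card + B.card) :
    ∃ e : G, 1 < (B.filter (fun b => e + b ∈ A)).card ∧
      (B.filter (fun b => e + b ∈ A)).card < B.card := by
  obtain ⟨b₀, hb₀⟩ : B.Nonempty := Finset.card_pos.1 (by omega)
  by_contra! hcon
  let X := A.filter (fun a => ∃ b ∈ B, a - b₀ + b ∉ A)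
  have hXA : X ⊆ A := Finset.filter_subset _ _
  have hX : ∀ x ∈ X, ∀ b ∈ B.erase b₀, x - b₀ + b ∉ A := by
    intro x hx b hb hmem
    obtain ⟨hxA, c, hc, hcA⟩ := Finset.mem_filter.1 hx
    have h1 : 1 < (B.filter (fun b => x - b₀ + b ∈ A)).card :=
      Finset.one_lt_card.2 ⟨b₀, by simp [hb₀, hxA], b,
        Finset.mem_filter.2 ⟨Finset.mem_of_mem_erase hb, hmem⟩, (Finset.ne_of_mem_erase hb).symm⟩
    have h2 : (B.filter (fun b => x - b₀ + b ∈ A)).card < B.card :=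
      Finset.card_lt_card (Finset.filter_ssubset.2 ⟨c, hc, hcA⟩)
    exact absurd (hcon _ h1) (by omega)
  have hBe : (B.erase b₀).card = B.card - 1 := Finset.card_erase_of_mem hb₀
  have hXcard : X.card ≤ 1 := by
    rcases X.eq_empty_or_nonempty with h | hne
    · simp [h]
    have hsub : A.image (· + b₀) ∪ (X + B.erase b₀) ⊆ A + B := by
      apply Finset.union_subset
      · intro y hy
        obtain ⟨a, ha, rfl⟩ := Finset.mem_image.1 hy
        exact Finset.add_mem_add ha hb₀
      · exact Finset.add_subset_add hXA (Finset.erase_subset _ _)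
    have hdisj : Disjoint (A.image (· + b₀)) (X + B.erase b₀) := by
      rw [Finset.disjoint_left]
      intro y hy hy'
      obtain ⟨a, ha, rfl⟩ := Finset.mem_image.1 hy
      obtain ⟨x, hx, b, hb, hxb⟩ := Finset.mem_add.1 hy'
      refine hX x hx b hb ?_
      have : x - b₀ + b = a := by rw [sub_add_eq_add_sub, hxb]; simp
      rwa [this]
    have h1 := Finset.card_le_card hsub
    rw [Finset.card_union_of_disjoint hdisj,
      Finset.card_image_of_injective _ (add_left_injective b₀)] at h1
    have h2 := card_add_card_le_of_lt_addOrderOf hp hne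
      (Finset.card_pos.1 (by omega) : (B.erase b₀).Nonempty) (by omega)
    omega
  have hY : (A \ X).card = A.card - X.card := Finset.card_sdiff_of_subset hXA
  have hsub : (A \ X) + B ⊆ A.image (· + b₀) := by
    intro y hy
    obtain ⟨a, ha, b, hb, rfl⟩ := Finset.mem_add.1 hy
    rw [Finset.mem_sdiff] at ha
    refine Finset.mem_image.2 ⟨a - b₀ + b, ?_, by abel⟩
    by_contra hmem
    exact ha.2 (Finset.mem_filter.2 ⟨ha.1, b, hb, hmem⟩)
  have h1 := (Finset.card_le_card hsub).trans Finset.card_image_le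
  have h2 := card_add_card_le_of_lt_addOrderOf hp
    (Finset.card_pos.1 (by omega) : (A \ X).Nonempty) ⟨b₀, hb₀⟩ (by omega)
  omega

/-- Vosper's theorem in an abelian group whose nonzero elements all have order greater than
`|A| + |B|`. -/
lemma exists_eq_image_range_of_critical {G : Type*} [AddCommGroup G] [DecidableEq G]
    (A B : Finset G) (hA : 1 < A.card) (hB : 1 < B.card)
    (hcrit : (A + B).card + 1 = A.card + B.card)
    (hp : ∀ d : G, d ≠ 0 → A.card + B.card < addOrderOf d) :
    ∃ d : G, (∃ a, A = (Finset.range A.card).image (fun i : ℕ => a + i • d)) ∧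
      ∃ b, B = (Finset.range B.card).image (fun i : ℕ => b + i • d) := by
  have hAne : A.Nonempty := Finset.card_pos.1 (by omega)
  have hBne : B.Nonempty := Finset.card_pos.1 (by omega)
  suffices h : ∃ d : G, d ≠ 0 ∧ (A + B + {0, d}).card ≤ A.card + B.card by
    obtain ⟨d, hd, hcard⟩ := h
    have hpair : ({0, d} : Finset G).Nonempty := ⟨0, by simp⟩
    have hord := hp d hd
    refine ⟨d, exists_eq_image_range_of_card_add_pair_le hAne (by omega) ?_,
      exists_eq_image_range_of_card_add_pair_le hBne (by omega) ?_⟩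
    · rw [add_right_comm] at hcard
      have := card_add_card_le_of_lt_addOrderOf hp (hAne.add hpair) hBne hcard
      omega
    · rw [add_assoc] at hcard
      have := card_add_card_le_of_lt_addOrderOf hp hAne (hBne.add hpair) hcard
      omega
  rcases (show B.card = 2 ∨ 2 < B.card by omega) with hB2 | hB2
  · obtain ⟨b, c, hbc, hBeq⟩ := Finset.card_eq_two.1 hB2
    have hd : c - b ≠ 0 := sub_ne_zero.2 hbc.symm
    have hord := hp _ hd
    have hBimg : B = (Finset.range 2).image (fun i : ℕ => b + i • (c - b)) := by
      rw [hBeq]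
      ext x
      simp [Finset.range_add_one, or_comm]
    have hAB : A + {0, c - b} = A + B + {-b} := by
      rw [hBeq, add_assoc]
      congr 1
      ext x
      simp [Finset.mem_add, sub_eq_add_neg, eq_comm]
    obtain ⟨a, ha⟩ := exists_eq_image_range_of_card_add_pair_le hAne
      (by omega : A.card < addOrderOf (c - b))
      (by rw [hAB, Finset.card_add_singleton]; omega)
    refine ⟨c - b, hd, ?_⟩
    rw [hB2]
    exact card_add_add_pair_le ha hBimg
  · obtain ⟨e, he1, he2⟩ := exists_dyson_transform hp hA hB2 hcrit
    set B' := B.filter (fun b => e + b ∈ A) with hB'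
    set A' := A ∪ B.image (e + ·) with hA'
    have hint : A ∩ B.image (e + ·) = B'.image (e + ·) := by
      ext x
      simp only [hB', Finset.mem_inter, Finset.mem_image, Finset.mem_filter]
      constructor
      · rintro ⟨hx, b, hb, rfl⟩
        exact ⟨b, ⟨hb, hx⟩, rfl⟩
      · rintro ⟨b, ⟨hb, hx⟩, rfl⟩
        exact ⟨hx, b, hb, rfl⟩
    have hcard : A'.card + B'.card = A.card + B.card := by
      have := Finset.card_union_add_card_inter A (B.image (e + ·))
      rwa [hint, Finset.card_image_of_injective _ (add_right_injective e),
        Finset.card_image_of_injective _ (add_right_injective e)] at this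
    have hsub : A' + B' ⊆ A + B := by
      intro x hx
      obtain ⟨a, ha, b, hb, rfl⟩ := Finset.mem_add.1 hx
      obtain ⟨hbB, hbA⟩ := Finset.mem_filter.1 hb
      rcases Finset.mem_union.1 ha with ha | ha
      · exact Finset.add_mem_add ha hbB
      · obtain ⟨c, hc, rfl⟩ := Finset.mem_image.1 ha
        rw [add_right_comm]
        exact Finset.add_mem_add hbA hc
    have hle := Finset.card_le_card hsub
    have hA'card : A.card ≤ A'.card := Finset.card_le_card Finset.subset_union_left
    have hcd := card_add_card_le_of_lt_addOrderOf hp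
      (Finset.card_pos.1 (by omega) : A'.Nonempty)
      (Finset.card_pos.1 (by omega) : B'.Nonempty) (by omega)
    have heq : A' + B' = A + B := Finset.eq_of_subset_of_card_le hsub (by omega)
    obtain ⟨d, ⟨a, ha⟩, b, hb⟩ := exists_eq_image_range_of_critical A' B' (by omega) he1
      (by omega) (fun d hd => hcard ▸ hp d hd)
    refine ⟨d, ?_, ?_⟩
    · rintro rfl
      have hone : B'.card ≤ 1 := by
        refine Finset.card_le_one.2 fun x hx y hy => ?_
        rw [hb] at hx hy
        obtain ⟨i, -, rfl⟩ := Finset.mem_image.1 hx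
        obtain ⟨j, -, rfl⟩ := Finset.mem_image.1 hy
        simp
      omega
    · rw [← heq, ← hcard]
      exact card_add_add_pair_le ha hb
termination_by B.card

theorem kemperman_critical_pair {G : Type*} [AddCommGroup G] [Fintype G]
    [DecidableEq G] (A B : Finset G) (hA : 1 < A.card) (hB : 1 < B.card)
    (hcrit : (A + B).card + 1 = A.card + B.card)
    (hG : (A + B).card < Fintype.card G)
    (hp : pGT G (A.card + B.card)) :
    ∃ x : G, IsAPWith x (A : Set G) ∧ IsAPWith x (B : Set G) := by
  have hord : ∀ d : G, d ≠ 0 → A.card + B.card < addOrderOf d := by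
    intro d hd
    rw [← Nat.card_zmultiples]
    exact hp _ (AddSubgroup.zmultiples_ne_bot.2 hd) inferInstance
  obtain ⟨d, ⟨a, ha⟩, b, hb⟩ := exists_eq_image_range_of_critical A B hA hB hcrit hord
  refine ⟨d, ⟨a, A.card, by omega, ?_⟩, b, B.card, by omega, ?_⟩
  · conv_lhs => rw [ha]
    simp
  · conv_lhs => rw [hb]
    simp
end

section
/- Let A and B be nonempty finite subsets of a group G. If there exists an element c ∈ A+B that can be written in exactly one way as c = a + b with a ∈ A and b ∈ B, then |A+B| ≥ |A| + |B| − 1. -/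
open scoped Pointwise

/-- If `(a₀, b₀)` is the only pair in `A × B` with sum `a₀ + b₀`, then
`|A| + |B| ≤ |A + B| + 1`. When the translates `A + b₀` and `a₀ + B` share an element other than
`a₀ + b₀`, both of the transforms `Finset.addETransformLeft` and `Finset.addETransformRight`
along a suitable `g` preserve the existence of such a pair. -/
theorem card_add_card_le_of_unique_sum {G : Type*} [AddGroup G] [DecidableEq G] (N : ℕ)
    (A B : Finset G) (a₀ b₀ : G) (ha₀ : a₀ ∈ A) (hb₀ : b₀ ∈ B)
    (h : ∀ a ∈ A, ∀ b ∈ B, a + b = a₀ + b₀ → a = a₀ ∧ b = b₀) (hN : (A + B).card ≤ N) :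
    A.card + B.card ≤ (A + B).card + 1 := by
  by_cases hab : ∀ a ∈ A, ∀ b ∈ B, a + b₀ = a₀ + b → a = a₀
  · have hinter : (A + {b₀}) ∩ ({a₀} + B) ⊆ {a₀ + b₀} := by
      intro x hx
      simp only [Finset.mem_inter, Finset.mem_add, Finset.mem_singleton, exists_eq_left] at hx ⊢
      obtain ⟨⟨a, ha, rfl⟩, b, hb, hx⟩ := hx
      rw [hab a ha b hb hx.symm]
    have hunion : (A + {b₀}) ∪ ({a₀} + B) ⊆ A + B :=
      Finset.union_subset (Finset.add_subset_add_left (by simpa using hb₀))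
        (Finset.add_subset_add_right (by simpa using ha₀))
    have hcard := Finset.card_union_add_card_inter (A + {b₀}) ({a₀} + B)
    rw [Finset.card_add_singleton, Finset.card_singleton_add] at hcard
    have := Finset.card_le_card hinter
    have := Finset.card_le_card hunion
    simp only [Finset.card_singleton] at *
    omega
  push Not at hab
  obtain ⟨a, ha, b, hb, hab, hne⟩ := hab
  obtain ⟨g, rfl⟩ : ∃ g, a = a₀ + g := ⟨-a₀ + a, by simp⟩
  obtain rfl : b = g + b₀ := by simpa [add_assoc] using hab.symm
  have hnegA : ∀ x ∈ A, x + g ≠ a₀ := fun x hx hxg ↦ by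
    obtain ⟨-, hb⟩ := h x hx _ hb (by rw [← add_assoc, hxg])
    simp_all
  have hnegB : ∀ y ∈ B, g + y ≠ b₀ := fun y hy hgy ↦ by
    obtain ⟨ha, -⟩ := h _ ha y hy (by rw [add_assoc, hgy])
    simp_all
  have hsubL : ((A ∩ (AddOpposite.op g +ᵥ A)) + (B ∪ (-g +ᵥ B))).card ≤ (A + B).card :=
    Finset.card_le_card (Finset.addETransformLeft.fst_add_snd_subset g (A, B))
  have hsubR : ((A ∪ (AddOpposite.op g +ᵥ A)) + (B ∩ (-g +ᵥ B))).card ≤ (A + B).card :=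
    Finset.card_le_card (Finset.addETransformRight.fst_add_snd_subset g (A, B))
  have hNA := (Finset.card_le_card_add_right (s := A) ⟨b₀, hb₀⟩).trans hN
  have hNB := (Finset.card_le_card_add_left (t := B) ⟨a₀, ha₀⟩).trans hN
  have memA (x : G) : x ∈ AddOpposite.op g +ᵥ A ↔ ∃ y ∈ A, y + g = x := by
    simp [Finset.mem_vadd_finset]
  have memB (x : G) : x ∈ -g +ᵥ B ↔ ∃ y ∈ B, -g + y = x := by
    simp [Finset.mem_vadd_finset]
  obtain hle | hlt : A.card + B.card ≤
      (A ∩ (AddOpposite.op g +ᵥ A)).card + (B ∪ (-g +ᵥ B)).card ∨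
      A.card + B.card < (A ∪ (AddOpposite.op g +ᵥ A)).card + (B ∩ (-g +ᵥ B)).card :=
    le_or_lt_of_add_le_add (Finset.AddETransform.card g (A, B)).ge
  · have hcard : (A ∩ (AddOpposite.op g +ᵥ A)).card < A.card := by
      refine Finset.card_lt_card ⟨Finset.inter_subset_left, fun hA ↦ ?_⟩
      obtain ⟨y, hy, hyg⟩ := (memA _).1 (Finset.mem_inter.1 (hA ha₀)).2
      exact hnegA y hy hyg
    have ih := card_add_card_le_of_unique_sum N (A ∩ (AddOpposite.op g +ᵥ A)) (B ∪ (-g +ᵥ B))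
      (a₀ + g) (-g + b₀) (Finset.mem_inter.2 ⟨ha, (memA _).2 ⟨a₀, ha₀, rfl⟩⟩)
      (Finset.mem_union_right _ ((memB _).2 ⟨b₀, hb₀, rfl⟩)) ?_ (hsubL.trans hN)
    · omega
    intro x hx y hy hxy
    obtain ⟨hx, hx'⟩ := Finset.mem_inter.1 hx
    obtain ⟨z, hz, rfl⟩ := (memA _).1 hx'
    obtain hy | hy := Finset.mem_union.1 hy
    · exact absurd (h _ hx y hy (by simpa [add_assoc] using hxy)).1 (hnegA z hz)
    · obtain ⟨w, hw, rfl⟩ := (memB _).1 hy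
      obtain ⟨rfl, rfl⟩ := h z hz w hw (by simpa [add_assoc] using hxy)
      exact ⟨rfl, rfl⟩
  · have ih := card_add_card_le_of_unique_sum N (A ∪ (AddOpposite.op g +ᵥ A)) (B ∩ (-g +ᵥ B))
      a₀ b₀ (Finset.mem_union_left _ ha₀)
      (Finset.mem_inter.2 ⟨hb₀, (memB _).2 ⟨g + b₀, hb, by simp⟩⟩) ?_ (hsubR.trans hN)
    · omega
    intro x hx y hy hxy
    obtain ⟨hy, hy'⟩ := Finset.mem_inter.1 hy
    obtain hx | hx := Finset.mem_union.1 hx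
    · exact h x hx y hy hxy
    · obtain ⟨z, hz, rfl⟩ := (memA _).1 hx
      obtain ⟨w, hw, rfl⟩ := (memB _).1 hy'
      obtain ⟨rfl, rfl⟩ := h z hz w hw (by simpa [add_assoc] using hxy)
      exact absurd (by simp) (hnegB _ hy)
termination_by (2 * N + 1 - (A.card + B.card), A.card)
decreasing_by
  all_goals rw [Prod.lex_def]; dsimp only; omega

theorem kemperman_unique_expression {G : Type*} [AddGroup G] [DecidableEq G]
    (A B : Finset G) (hA : A.Nonempty) (hB : B.Nonempty)
    (hc : ∃ c ∈ A + B, ∃! p : G × G, p.1 ∈ A ∧ p.2 ∈ B ∧ p.1 + p.2 = c) :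
    A.card + B.card ≤ (A + B).card + 1 := by
  obtain ⟨c, -, ⟨a₀, b₀⟩, ⟨ha₀, hb₀, rfl⟩, h⟩ := hc
  exact card_add_card_le_of_unique_sum _ A B a₀ b₀ ha₀ hb₀
    (fun a ha b hb hab ↦ Prod.mk.inj (h (a, b) ⟨ha, hb, hab⟩)) le_rfl
end
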